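/- Let Q be a quandle such that the natural map θ : Q → G_Q is injective, and let A be a set of representatives of the orbits of Q under the inner automorphism group. Then Q is isomorphic to the (G_Q, θ(A))-quandle Q(G_Q, θ(A)). -/

import Mathlib

open Quandles

namespace GA

variable {G : Type*} [Group G]

/-- The equivalence relation on `A × G`: `(a, gh) ~ (a, h)` for `g ∈ C_G(a)`,
i.e. `(a,u) ~ (b,v)` iff `a = b` and `u * v⁻¹` centralizes `a`. -/
def rel (A : Set G) (p q : A × G) : Prop :=
  p.1 = q.1 ∧ p.2 * q.2⁻¹ ∈ Subgroup.centralizer ({(p.1 : G)} : Set G)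

theorem rel_equiv (A : Set G) : Equivalence (rel A) := by
  constructor
  · intro p
    exact ⟨rfl, by simpa using (Subgroup.centralizer ({(p.1 : G)} : Set G)).one_mem⟩
  · rintro p q ⟨h1, h2⟩
    refine ⟨h1.symm, ?_⟩
    have := (Subgroup.centralizer ({(p.1 : G)} : Set G)).inv_mem h2
    simpa [h1] using this
  · rintro p q r ⟨h1, h2⟩ ⟨h1', h2'⟩
    refine ⟨h1.trans h1', ?_⟩
    have := (Subgroup.centralizer ({(p.1 : G)} : Set G)).mul_mem h2 (by rw [h1]; exact h2')
    simpa [mul_assoc] using this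

instance setoid (A : Set G) : Setoid (A × G) := ⟨rel A, rel_equiv A⟩

/-- The `(G,A)`-quandle as a set: the quotient of `A × G` by `(a,gh) ~ (a,h)`, `g ∈ C_G(a)`. -/
def Q (G : Type*) [Group G] (A : Set G) : Type _ := Quotient (setoid A)

/-- The class of `(a,u)` in `Q(G,A)`. -/
def mk {A : Set G} (a : A) (u : G) : Q G A := Quotient.mk (setoid A) (a, u)

/-- representative-level operation `(a,u) * (b,v) = (a, u v⁻¹ b v)`,
written as a left action of `(b,v)` on `(a,u)`. -/
def pop {A : Set G} (x y : A × G) : A × G := (y.1, y.2 * x.2⁻¹ * (x.1 : G) * x.2)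

/-- representative-level inverse operation `(a,u) *⁻¹ (b,v) = (a, u v⁻¹ b⁻¹ v)`. -/
def pinv {A : Set G} (x y : A × G) : A × G := (y.1, y.2 * x.2⁻¹ * (x.1 : G)⁻¹ * x.2)

theorem centralizer_mem_iff {a u : G} : u ∈ Subgroup.centralizer ({a} : Set G) ↔ u * a = a * u := by
  rw [Subgroup.mem_centralizer_singleton_iff]

theorem conj_indep {b v d : G} (h : d * b = b * d) : ((d * v))⁻¹ * b * (d * v) = v⁻¹ * b * v := by
  have h' : d⁻¹ * b * d = b := by
    rw [mul_assoc, ← h]; group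
  calc (d * v)⁻¹ * b * (d * v) = v⁻¹ * (d⁻¹ * b * d) * v := by group
    _ = v⁻¹ * b * v := by rw [h']

theorem pop_well {A : Set G} : ∀ (x₁ y₁ x₂ y₂ : A × G), rel A x₁ x₂ → rel A y₁ y₂ →
    rel A (pop x₁ y₁) (pop x₂ y₂) := by
  rintro ⟨b₁, v₁⟩ ⟨a₁, u₁⟩ ⟨b₂, v₂⟩ ⟨a₂, u₂⟩ ⟨hb, hv⟩ ⟨ha, hu⟩
  refine ⟨ha, ?_⟩
  simp only [pop]
  rw [centralizer_mem_iff] at hv hu ⊢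
  have hb' : (b₁ : G) = (b₂ : G) := congrArg _ hb
  have key : v₁⁻¹ * (b₁ : G) * v₁ = v₂⁻¹ * (b₂ : G) * v₂ := by
    conv_lhs => rw [show v₁ = (v₁ * v₂⁻¹) * v₂ by group, hb']
    exact conj_indep (by rw [← hb']; exact hv)
  have heq : u₁ * v₁⁻¹ * (b₁:G) * v₁ * (u₂ * v₂⁻¹ * (b₂:G) * v₂)⁻¹ = u₁ * u₂⁻¹ := by
    calc u₁ * v₁⁻¹ * (b₁:G) * v₁ * (u₂ * v₂⁻¹ * (b₂:G) * v₂)⁻¹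
        = u₁ * (v₁⁻¹ * (b₁:G) * v₁) * (v₂⁻¹ * (b₂:G) * v₂)⁻¹ * u₂⁻¹ := by group
      _ = u₁ * (v₂⁻¹ * (b₂:G) * v₂) * (v₂⁻¹ * (b₂:G) * v₂)⁻¹ * u₂⁻¹ := by rw [key]
      _ = u₁ * u₂⁻¹ := by group
  rw [heq]
  exact hu

theorem pinv_well {A : Set G} : ∀ (x₁ y₁ x₂ y₂ : A × G), rel A x₁ x₂ → rel A y₁ y₂ →
    rel A (pinv x₁ y₁) (pinv x₂ y₂) := by
  rintro ⟨b₁, v₁⟩ ⟨a₁, u₁⟩ ⟨b₂, v₂⟩ ⟨a₂, u₂⟩ ⟨hb, hv⟩ ⟨ha, hu⟩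
  refine ⟨ha, ?_⟩
  simp only [pinv]
  rw [centralizer_mem_iff] at hv hu ⊢
  have hb' : (b₁ : G) = (b₂ : G) := congrArg _ hb
  have hvc : (v₁ * v₂⁻¹) * (b₂ : G)⁻¹ = (b₂ : G)⁻¹ * (v₁ * v₂⁻¹) := by
    have : Commute (v₁ * v₂⁻¹) (b₂ : G) := by rw [← hb']; exact hv
    exact this.inv_right
  have key : v₁⁻¹ * (b₁ : G)⁻¹ * v₁ = v₂⁻¹ * (b₂ : G)⁻¹ * v₂ := by
    conv_lhs => rw [show v₁ = (v₁ * v₂⁻¹) * v₂ by group, hb']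
    exact conj_indep hvc
  have heq : u₁ * v₁⁻¹ * (b₁:G)⁻¹ * v₁ * (u₂ * v₂⁻¹ * (b₂:G)⁻¹ * v₂)⁻¹ = u₁ * u₂⁻¹ := by
    calc u₁ * v₁⁻¹ * (b₁:G)⁻¹ * v₁ * (u₂ * v₂⁻¹ * (b₂:G)⁻¹ * v₂)⁻¹
        = u₁ * (v₁⁻¹ * (b₁:G)⁻¹ * v₁) * (v₂⁻¹ * (b₂:G)⁻¹ * v₂)⁻¹ * u₂⁻¹ := by group
      _ = u₁ * (v₂⁻¹ * (b₂:G)⁻¹ * v₂) * (v₂⁻¹ * (b₂:G)⁻¹ * v₂)⁻¹ * u₂⁻¹ := by rw [key]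
      _ = u₁ * u₂⁻¹ := by group
  rw [heq]
  exact hu

instance quandle (G : Type*) [Group G] (A : Set G) : Quandle (Q G A) where
  act := Quotient.map₂ pinv (fun _ _ h _ _ h' => pinv_well _ _ _ _ h h')
  invAct := Quotient.map₂ pop (fun _ _ h _ _ h' => pop_well _ _ _ _ h h')
  self_distrib := by
    rintro ⟨⟨b,v⟩⟩ ⟨⟨c,w⟩⟩ ⟨⟨a,u⟩⟩
    refine Quotient.sound ⟨rfl, ?_⟩
    simp only [pinv]
    rw [centralizer_mem_iff]
    group
  left_inv := by
    rintro ⟨⟨b,v⟩⟩ ⟨⟨a,u⟩⟩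
    refine Quotient.sound ⟨rfl, ?_⟩
    simp only [pop, pinv]
    rw [centralizer_mem_iff]
    group
  right_inv := by
    rintro ⟨⟨b,v⟩⟩ ⟨⟨a,u⟩⟩
    refine Quotient.sound ⟨rfl, ?_⟩
    simp only [pop, pinv]
    rw [centralizer_mem_iff]
    group
  fix := by
    rintro ⟨⟨a,u⟩⟩
    refine Quotient.sound ⟨rfl, ?_⟩
    simp only [pinv]
    rw [centralizer_mem_iff]
    have : (u * u⁻¹ * (a:G)⁻¹ * u) * u⁻¹ = (a : G)⁻¹ := by group
    rw [this]
    group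

@[simp] theorem invAct_mk {A : Set G} (a b : A) (u v : G) :
    Rack.invAct (mk b v) (mk a u) = mk a (u * v⁻¹ * (b : G) * v) := rfl

@[simp] theorem act_mk {A : Set G} (a b : A) (u v : G) :
    Shelf.act (mk b v) (mk a u) = mk a (u * v⁻¹ * (b : G)⁻¹ * v) := rfl

end GA

/-- Two elements of a rack lie in the same orbit under the inner automorphism group iff they
are related by the equivalence relation generated by `a ~ x ◃ a` and `a ~ x ◃⁻¹ a`. -/
def sameOrbit (Q : Type*) [Rack Q] : Q → Q → Prop :=
  Relation.EqvGen (fun a b => ∃ x : Q, b = x ◃ a ∨ b = x ◃⁻¹ a)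

namespace Rack.EnvelGroup

variable {R : Type*} [Rack R]

/-- Induction principle for the enveloping group: it is generated by the image of the rack. -/
theorem induction {p : EnvelGroup R → Prop} (one : p 1)
    (of : ∀ x : R, p (toEnvelGroup R x)) (mul : ∀ g h : EnvelGroup R, p g → p h → p (g * h))
    (inv : ∀ g : EnvelGroup R, p g → p g⁻¹) (g : EnvelGroup R) : p g := by
  induction g using Quotient.inductionOn with
  | h w =>
    induction w with
    | unit => exact one
    | incl x => exact of x
    | mul a b ha hb => exact mul _ _ ha hb
    | inv a ha => exact inv _ ha

theorem envelAction_inv_toEnvelGroup (x y : R) :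
    envelAction ((toEnvelGroup R x : EnvelGroup R)⁻¹) y = x ◃⁻¹ y := by
  rw [map_inv]
  rfl

/-- The map to the enveloping group is equivariant for conjugation. -/
theorem toEnvelGroup_envelAction (g : EnvelGroup R) (x : R) :
    (toEnvelGroup R (envelAction g x) : EnvelGroup R) =
      g * (toEnvelGroup R x : EnvelGroup R) * g⁻¹ := by
  induction g using induction generalizing x with
  | one => simp
  | of y => exact (toEnvelGroup R).map_act
  | mul g h hg hh =>
    rw [map_mul, Equiv.Perm.mul_apply, hg, hh]
    group
  | inv g hg =>
    have h := hg (envelAction g⁻¹ x)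
    rw [← Equiv.Perm.mul_apply, ← map_mul, mul_inv_cancel, map_one, Equiv.Perm.one_apply] at h
    rw [h]
    group

end Rack.EnvelGroup

theorem sameOrbit_iff_exists_envelAction {R : Type*} [Rack R] {a b : R} :
    sameOrbit R a b ↔ ∃ g : Rack.EnvelGroup R, Rack.envelAction g a = b := by
  constructor
  · intro h
    induction h with
    | rel a b h =>
      obtain ⟨x, rfl | rfl⟩ := h
      · exact ⟨Rack.toEnvelGroup R x, rfl⟩
      · exact ⟨_, Rack.EnvelGroup.envelAction_inv_toEnvelGroup x a⟩
    | refl a => exact ⟨1, by simp⟩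
    | symm a b _ ih =>
      obtain ⟨g, rfl⟩ := ih
      exact ⟨g⁻¹, by simp⟩
    | trans a b c _ _ ih₁ ih₂ =>
      obtain ⟨g, rfl⟩ := ih₁
      obtain ⟨h, rfl⟩ := ih₂
      exact ⟨h * g, by simp⟩
  · rintro ⟨g, rfl⟩
    induction g using Rack.EnvelGroup.induction generalizing a with
    | one => exact .refl a
    | of x => exact .rel _ _ ⟨x, Or.inl rfl⟩
    | mul g h hg hh =>
      rw [map_mul, Equiv.Perm.mul_apply]
      exact .trans _ _ _ hh hg
    | inv g hg =>
      have h := hg (a := Rack.envelAction g⁻¹ a)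
      rw [← Equiv.Perm.mul_apply, ← map_mul, mul_inv_cancel, map_one, Equiv.Perm.one_apply] at h
      exact .symm _ _ h

namespace GA

variable {G : Type*} [Group G] {A : Set G}

/-- The map `Q(G,A) → G` sending `[(a,u)]` to `u⁻¹ a u`. -/
def toConj : Q G A → G :=
  Quotient.lift (fun p : A × G => p.2⁻¹ * (p.1 : G) * p.2) (by
    rintro ⟨a, u⟩ ⟨b, v⟩ ⟨hab, huv⟩
    obtain rfl : a = b := hab
    rw [centralizer_mem_iff] at huv
    simpa using conj_indep (v := v) huv)

@[simp] theorem toConj_mk (a : A) (u : G) : toConj (mk a u) = u⁻¹ * (a : G) * u := rfl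

theorem exists_mk (p : Q G A) : ∃ (a : A) (u : G), mk a u = p := by
  induction p using Quotient.inductionOn with
  | h p => exact ⟨p.1, p.2, rfl⟩

theorem toConj_act (p q : Q G A) : toConj (p ◃ q) = toConj p * toConj q * (toConj p)⁻¹ := by
  obtain ⟨b, v, rfl⟩ := exists_mk p
  obtain ⟨a, u, rfl⟩ := exists_mk q
  simp only [act_mk, toConj_mk]
  group

/-- Classes over the same base point with the same conjugate coincide. -/
theorem mk_eq_mk_of_conj_eq {a : A} {u v : G} (h : u⁻¹ * (a : G) * u = v⁻¹ * (a : G) * v) :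
    mk a u = mk a v := by
  refine Quotient.sound ⟨rfl, ?_⟩
  rw [centralizer_mem_iff]
  calc u * v⁻¹ * (a : G) = u * (v⁻¹ * (a : G) * v) * v⁻¹ := by group
    _ = u * (u⁻¹ * (a : G) * u) * v⁻¹ := by rw [h]
    _ = (a : G) * (u * v⁻¹) := by group

end GA

/-- Let `Q` be a quandle such that the natural map `θ : Q → G_Q` to its enveloping group is
injective, and let `A` be a set of representatives of the orbits of `Q` under the inner
automorphism group. Then `Q` is isomorphic to the `(G_Q, θ(A))`-quandle `Q(G_Q, θ(A))`. -/
theorem quandle_iso_GA_of_toEnvelGroup_injective (Q : Type*) [Quandle Q]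
    (hinj : Function.Injective (fun x : Q => (Rack.toEnvelGroup Q x : Rack.EnvelGroup Q)))
    (A : Set Q) (hA : ∀ q : Q, ∃! a : Q, a ∈ A ∧ sameOrbit Q a q) :
    ∃ f : Q ≃ GA.Q (Rack.EnvelGroup Q)
        ((fun x : Q => (Rack.toEnvelGroup Q x : Rack.EnvelGroup Q)) '' A),
      (∀ x y : Q, f (x ◃ y) = f x ◃ f y) ∧
      (∀ x y : Q, f (x ◃⁻¹ y) = f x ◃⁻¹ f y) := by
  have hconj : ∀ p : GA.Q (Rack.EnvelGroup Q)
      ((fun x : Q => (Rack.toEnvelGroup Q x : Rack.EnvelGroup Q)) '' A),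
      ∃ q : Q, (Rack.toEnvelGroup Q q : Rack.EnvelGroup Q) = GA.toConj p := by
    intro p
    obtain ⟨⟨_, a, ha, rfl⟩, u, rfl⟩ := GA.exists_mk p
    exact ⟨Rack.envelAction u⁻¹ a, by
      rw [Rack.EnvelGroup.toEnvelGroup_envelAction, inv_inv, GA.toConj_mk]⟩
  choose e he using hconj
  have e_mk : ∀ (a : Q) (ha : a ∈ A) (u : Rack.EnvelGroup Q),
      e (GA.mk ⟨_, a, ha, rfl⟩ u) = Rack.envelAction u⁻¹ a := by
    intro a ha u
    apply hinj
    simp only [he, Rack.EnvelGroup.toEnvelGroup_envelAction, inv_inv, GA.toConj_mk]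
  have e_inj : Function.Injective e := by
    intro p q hpq
    obtain ⟨⟨_, a, ha, rfl⟩, u, rfl⟩ := GA.exists_mk p
    obtain ⟨⟨_, b, hb, rfl⟩, v, rfl⟩ := GA.exists_mk q
    have hab : a = b := by
      refine (hA (Rack.envelAction u⁻¹ a)).unique
        ⟨ha, sameOrbit_iff_exists_envelAction.2 ⟨_, rfl⟩⟩
        ⟨hb, sameOrbit_iff_exists_envelAction.2 ⟨v⁻¹, ?_⟩⟩
      rw [← e_mk a ha, ← e_mk b hb, hpq]
    subst hab
    apply GA.mk_eq_mk_of_conj_eq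
    rw [← GA.toConj_mk, ← GA.toConj_mk, ← he, ← he, hpq]
  have e_surj : Function.Surjective e := by
    intro q
    obtain ⟨a, ⟨ha, haq⟩, -⟩ := hA q
    obtain ⟨g, rfl⟩ := sameOrbit_iff_exists_envelAction.1 haq
    exact ⟨GA.mk ⟨_, a, ha, rfl⟩ g⁻¹, by rw [e_mk a ha, inv_inv]⟩
  have e_act : ∀ p q, e (p ◃ q) = e p ◃ e q := by
    intro p q
    apply hinj
    simp only [he, GA.toConj_act, ShelfHom.map_act, Quandle.conj_act_eq_conj]
  let f := (Equiv.ofBijective e ⟨e_inj, e_surj⟩).symm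
  have e_f : ∀ x, e (f x) = x := (Equiv.ofBijective e ⟨e_inj, e_surj⟩).apply_symm_apply
  have f_act : ∀ x y : Q, f (x ◃ y) = f x ◃ f y := by
    intro x y
    apply e_inj
    rw [e_act, e_f, e_f, e_f]
  refine ⟨f, f_act, fun x y => ?_⟩
  rw [← Rack.left_cancel (f x), ← f_act, Rack.right_inv, Rack.right_inv]
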